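/- For every r ≥ 3 there is a constant C_r such that for every sufficiently large n there exists an M(K_{1,r})-saturated simple graph on n vertices with at most n + C_r edges. -/

import Mathlib

/-- `H.IsMinorOf G` : `H` is a minor of `G`, via the branch-set (model) definition:
there are pairwise disjoint nonempty connected subsets of `V(G)`, one for each vertex
of `H`, with an edge of `G` between the branch sets corresponding to each edge of `H`. -/
def SimpleGraph.IsMinorOf {W V : Type*} (H : SimpleGraph W) (G : SimpleGraph V) : Prop :=
  ∃ B : W → Set V,
    (∀ w, (B w).Nonempty) ∧
    (∀ w, (G.induce (B w)).Connected) ∧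
    (Pairwise fun w₁ w₂ => Disjoint (B w₁) (B w₂)) ∧
    ∀ ⦃w₁ w₂⦄, H.Adj w₁ w₂ → ∃ v₁ ∈ B w₁, ∃ v₂ ∈ B w₂, G.Adj v₁ v₂

/-- The graph `G + uv` obtained from `G` by adding the edge `uv`. -/
def SimpleGraph.addEdge {V : Type*} (G : SimpleGraph V) (u v : V) : SimpleGraph V :=
  G ⊔ SimpleGraph.fromEdgeSet {s(u, v)}

/-- `G` is `M(H)`-saturated: `G` has no `H`-minor, but adding any edge between two
distinct non-adjacent vertices creates an `H`-minor. -/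
def MinorSaturated {W V : Type*} (H : SimpleGraph W) (G : SimpleGraph V) : Prop :=
  ¬ H.IsMinorOf G ∧
    ∀ u v : V, u ≠ v → ¬ G.Adj u v → H.IsMinorOf (G.addEdge u v)

namespace SimpleGraph

variable {V W : Type*}

theorem IsMinorOf.mono {H : SimpleGraph W} {G G' : SimpleGraph V} (h : G ≤ G')
    (hG : H.IsMinorOf G) : H.IsMinorOf G' := by
  obtain ⟨B, hne, hconn, hdisj, hadj⟩ := hG
  refine ⟨B, hne, fun w => (hconn w).mono (comap_monotone _ h), hdisj, fun w₁ w₂ hw => ?_⟩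
  obtain ⟨v₁, h₁, v₂, h₂, hv⟩ := hadj hw
  exact ⟨v₁, h₁, v₂, h₂, h hv⟩

theorem induce_connected_of_rank {G : SimpleGraph V} {S : Set V} {a : V} (ha : a ∈ S)
    (f : V → ℕ) (h : ∀ x ∈ S, x ≠ a → ∃ y ∈ S, f y < f x ∧ G.Adj y x) :
    (G.induce S).Connected := by
  have key (m : ℕ) : ∀ x : S, f x = m → (G.induce S).Reachable ⟨a, ha⟩ x := by
    induction m using Nat.strong_induction_on with
    | _ m ih =>
      rintro ⟨x, hx⟩ hm
      by_cases hxa : x = a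
      · subst hxa
        exact .rfl
      · obtain ⟨y, hy, hlt, hadj⟩ := h x hx hxa
        exact (ih _ (hm ▸ hlt) ⟨y, hy⟩ rfl).trans
          (Adj.reachable (G := G.induce S) (u := ⟨y, hy⟩) (v := ⟨x, hx⟩) hadj)
  have : Nonempty S := ⟨⟨a, ha⟩⟩
  exact { preconnected := fun x y => (key _ x rfl).symm.trans (key _ y rfl) }

/-- A graph has a `K_{1,r}`-minor iff some connected set has `r` distinct outside neighbours. -/
theorem star_isMinorOf_iff {G : SimpleGraph V} {r : ℕ} :
    (completeBipartiteGraph (Fin 1) (Fin r)).IsMinorOf G ↔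
      ∃ S : Set V, (G.induce S).Connected ∧ ∃ t : Fin r → V, Function.Injective t ∧
        ∀ i, t i ∉ S ∧ ∃ s ∈ S, G.Adj s (t i) := by
  constructor
  · rintro ⟨B, -, hconn, hdisj, hadj⟩
    have key (i : Fin r) : ∃ v ∈ B (.inr i), ∃ s ∈ B (.inl 0), G.Adj s v := by
      obtain ⟨s, hs, v, hv, h⟩ := @hadj (.inl 0) (.inr i) (by simp)
      exact ⟨v, hv, s, hs, h⟩
    choose t ht s hs hst using key
    refine ⟨B (.inl 0), hconn _, t, fun i j hij => ?_, fun i => ⟨fun h => ?_, s i, hs i, hst i⟩⟩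
    · by_contra hne
      have := hdisj (show (Sum.inr i : Fin 1 ⊕ Fin r) ≠ .inr j by simpa using hne)
      exact Set.disjoint_left.1 this (ht i) (hij ▸ ht j)
    · exact Set.disjoint_left.1 (hdisj (Sum.inl_ne_inr (a := (0 : Fin 1)) (b := i))) h (ht i)
  · rintro ⟨S, hS, t, ht, hadj⟩
    refine ⟨Sum.elim (fun _ => S) (fun i => {t i}), ?_, ?_, ?_, ?_⟩
    · rintro (a | i)
      · exact Set.nonempty_coe_sort.1 hS.nonempty
      · simp
    · rintro (a | i)
      · exact hS
      · exact induce_connected_of_rank (a := t i) rfl (fun _ => 0) fun x hx h => absurd hx h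
    · rintro (a | i) (b | j) hne
      · exact absurd (congrArg Sum.inl (Subsingleton.elim a b)) hne
      · simpa using (hadj j).1
      · simpa using (hadj i).1
      · simpa using fun h => hne (congrArg Sum.inr (ht h))
    · rintro (a | i) (b | j) h
      · simp at h
      · obtain ⟨s, hs, hst⟩ := (hadj j).2
        exact ⟨s, hs, t j, rfl, hst⟩
      · obtain ⟨s, hs, hst⟩ := (hadj i).2
        exact ⟨t i, rfl, s, hs, hst.symm⟩
      · simp at h

theorem exists_adj_of_induce_connected {G : SimpleGraph V} {S T : Set V}
    (h : (G.induce S).Connected) {x y : V} (hx : x ∈ S) (hy : y ∈ S) (hxT : x ∈ T)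
    (hyT : y ∉ T) : ∃ a ∈ S, ∃ b ∈ S, a ∈ T ∧ b ∉ T ∧ G.Adj a b := by
  obtain ⟨p⟩ := h.preconnected ⟨x, hx⟩ ⟨y, hy⟩
  obtain ⟨d, -, h₁, h₂⟩ := p.exists_boundary_dart (Subtype.val ⁻¹' T) hxT hyT
  exact ⟨_, d.fst.2, _, d.snd.2, h₁, h₂, d.adj⟩

/-- The cycle `0, 1, …, c - 1` with the vertices `c, …, n - 1` as pendants attached to `0`. -/
def pendantCycle (n c : ℕ) : SimpleGraph (Fin n) :=
  fromRel fun a b => (a.1 + 1 = b.1 ∧ b.1 < c) ∨ (a.1 = 0 ∧ c ≤ b.1 + 1)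

theorem pendantCycle_adj {n c : ℕ} {a b : Fin n} :
    (pendantCycle n c).Adj a b ↔ a.1 ≠ b.1 ∧
      (((a.1 + 1 = b.1 ∧ b.1 < c) ∨ (a.1 = 0 ∧ c ≤ b.1 + 1)) ∨
        ((b.1 + 1 = a.1 ∧ a.1 < c) ∨ (b.1 = 0 ∧ c ≤ a.1 + 1))) := by
  simp [pendantCycle, Fin.ext_iff]

theorem addEdge_adj {G : SimpleGraph V} {u v a b : V} (h : u ≠ v) :
    (G.addEdge u v).Adj a b ↔ G.Adj a b ∨ (a = u ∧ b = v) ∨ (a = v ∧ b = u) := by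
  simp only [addEdge, sup_adj, fromEdgeSet_adj, Set.mem_singleton_iff, Sym2.eq_iff]
  grind

/-- An arc `(x, y)` of the cycle avoiding `0` cannot be left by a connected set avoiding its
ends. -/
theorem pendantCycle_arc {n c : ℕ} {S : Set (Fin n)}
    (hS : ((pendantCycle n c).induce S).Connected) {x y p q : Fin n} (hx : x ∉ S) (hy : y ∉ S)
    (hyc : y.1 < c) (hp : p ∈ S) (hq : q ∈ S) (hxp : x.1 < p.1) (hpy : p.1 < y.1)
    (hq' : q.1 < x.1 ∨ y.1 < q.1) : False := by
  obtain ⟨a, ha, b, hb, ⟨h₁, h₂⟩, hbT, hab⟩ := exists_adj_of_induce_connected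
    (T := {z | x.1 < z.1 ∧ z.1 < y.1}) hS hp hq ⟨hxp, hpy⟩ (by simp; omega)
  have hbx : b.1 ≠ x.1 := fun h => hx (Fin.ext h ▸ hb)
  have hby : b.1 ≠ y.1 := fun h => hy (Fin.ext h ▸ hb)
  rw [pendantCycle_adj] at hab
  simp only [Set.mem_ofPred_eq] at hbT
  omega

theorem not_star_isMinorOf_pendantCycle {n c r : ℕ} (hn : c + r = n + 3) (hr : 3 ≤ r) :
    ¬ (completeBipartiteGraph (Fin 1) (Fin r)).IsMinorOf (pendantCycle n c) := by
  classical
  rw [star_isMinorOf_iff]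
  rintro ⟨S, hS, t, ht, hadj⟩
  let P : Finset (Fin n) := Finset.univ.filter fun x => c ≤ x.1
  let R : Finset (Fin n) := Finset.univ.filter fun x =>
    x.1 < c ∧ x ∉ S ∧ ∃ s ∈ S, s.1 + 1 = x.1 ∨ (x.1 = 0 ∧ c ≤ s.1 + 1)
  let L : Finset (Fin n) := Finset.univ.filter fun x =>
    x.1 < c ∧ x ∉ S ∧ ∃ s ∈ S, x.1 + 1 = s.1 ∨ (x.1 + 1 = c ∧ s.1 = 0)
  have hP : P.card ≤ r - 3 := by
    have : P.card ≤ (Finset.Ico c n).card :=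
      Finset.card_le_card_of_injOn Fin.val (by intro x; simp [P]) Fin.val_injective.injOn
    rw [Nat.card_Ico] at this
    omega
  have hR : R.card ≤ 1 := by
    have key : ∀ x ∈ R, ∀ y ∈ R, ¬ x < y := by
      intro x hx y hy hxy
      simp only [R, Finset.mem_filter, Finset.mem_univ, true_and] at hx hy
      obtain ⟨hxc, hxS, q, hq, hqx⟩ := hx
      obtain ⟨hyc, hyS, p, hp, hpy⟩ := hy
      have h₁ : p.1 ≠ x.1 := fun h => hxS (Fin.ext h ▸ hp)
      have h₂ : q.1 ≠ y.1 := fun h => hyS (Fin.ext h ▸ hq)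
      rw [Fin.lt_def] at hxy
      exact pendantCycle_arc hS hxS hyS hyc hp hq (by omega) (by omega) (by omega)
    exact Finset.card_le_one.2 fun x hx y hy =>
      le_antisymm (not_lt.1 (key y hy x hx)) (not_lt.1 (key x hx y hy))
  have hL : L.card ≤ 1 := by
    have key : ∀ x ∈ L, ∀ y ∈ L, ¬ x < y := by
      intro x hx y hy hxy
      simp only [L, Finset.mem_filter, Finset.mem_univ, true_and] at hx hy
      obtain ⟨hxc, hxS, p, hp, hpx⟩ := hx
      obtain ⟨hyc, hyS, q, hq, hqy⟩ := hy
      have h₁ : p.1 ≠ y.1 := fun h => hyS (Fin.ext h ▸ hp)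
      have h₂ : q.1 ≠ x.1 := fun h => hxS (Fin.ext h ▸ hq)
      rw [Fin.lt_def] at hxy
      exact pendantCycle_arc hS hxS hyS hyc hp hq (by omega) (by omega) (by omega)
    exact Finset.card_le_one.2 fun x hx y hy =>
      le_antisymm (not_lt.1 (key y hy x hx)) (not_lt.1 (key x hx y hy))
  have hsub : Finset.univ.image t ⊆ P ∪ (R ∪ L) := by
    intro w hw
    obtain ⟨i, -, rfl⟩ := Finset.mem_image.1 hw
    obtain ⟨hwS, s, hs, hsw⟩ := hadj i
    rw [pendantCycle_adj] at hsw
    simp only [P, R, L, Finset.mem_union, Finset.mem_filter, Finset.mem_univ, true_and]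
    by_cases hwc : c ≤ (t i).1
    · exact .inl hwc
    · obtain h | h : (s.1 + 1 = (t i).1 ∨ ((t i).1 = 0 ∧ c ≤ s.1 + 1)) ∨
          ((t i).1 + 1 = s.1 ∨ ((t i).1 + 1 = c ∧ s.1 = 0)) := by omega
      · exact .inr (.inl ⟨by omega, hwS, s, hs, h⟩)
      · exact .inr (.inr ⟨by omega, hwS, s, hs, h⟩)
  have hcard := Finset.card_le_card hsub
  rw [Finset.card_image_of_injective _ ht, Finset.card_fin] at hcard
  have h₁ := Finset.card_union_le P (R ∪ L)
  have h₂ := Finset.card_union_le R L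
  omega

theorem star_isMinorOf_addEdge_pendantCycle {n c r : ℕ} (hc : 8 ≤ c) (hn : c + r = n + 3)
    (hr : 3 ≤ r) {u v : Fin n} (huv : u.1 < v.1) (hadj : ¬ (pendantCycle n c).Adj u v)
    (hX : ¬ ((u.1 < 3 ∨ c ≤ u.1 + 2) ∧ (v.1 < 3 ∨ c ≤ v.1 + 2))) :
    (completeBipartiteGraph (Fin 1) (Fin r)).IsMinorOf ((pendantCycle n c).addEdge u v) := by
  have hne : u ≠ v := Fin.ne_of_lt huv
  have hu := u.2
  have hv := v.2
  rw [pendantCycle_adj] at hadj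
  rw [star_isMinorOf_iff]
  simp only [addEdge_adj hne, pendantCycle_adj]
  obtain ⟨z, hz⟩ : ∃ z : Fin n, z.1 = 0 := ⟨⟨0, by omega⟩, rfl⟩
  by_cases hvc : c ≤ v.1
  · refine ⟨{z, v, u}, induce_connected_of_rank (a := z) (by simp)
      (fun x => if x = u then 2 else if x = v then 1 else 0) ?_,
      fun i => ⟨if i.1 + 3 = r then 1 else if i.1 + 2 = r then c - 1 else
        if i.1 + 1 = r then u.1 - 1 else if c + i.1 = v.1 then u.1 + 1 else c + i.1, ?_⟩, ?_, ?_⟩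
    · rintro x (rfl | rfl | rfl) hx
      · exact absurd rfl hx
      · refine ⟨z, by simp, ?_, ?_⟩
        · simp only [Fin.ext_iff]; split_ifs <;> omega
        · rw [addEdge_adj hne, pendantCycle_adj]; omega
      · refine ⟨v, by simp, ?_, ?_⟩
        · simp [hne.symm]
        · rw [addEdge_adj hne]; simp
    · have := i.2
      split_ifs <;> omega
    · intro i j hij
      simp only [Fin.mk.injEq] at hij
      ext
      split_ifs at hij <;> omega
    · intro i
      have := i.2
      simp only [Set.mem_insert_iff, Set.mem_singleton_iff]
      refine ⟨by simp only [Fin.ext_iff]; split_ifs <;> omega, ?_⟩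
      by_cases h : i.1 + 1 = r ∨ (c + i.1 = v.1 ∧ i.1 + 3 < r)
      · refine ⟨u, by simp, ?_⟩
        simp only [Fin.ext_iff, true_and]
        split_ifs <;> omega
      · refine ⟨z, by simp, ?_⟩
        simp only [Fin.ext_iff]
        split_ifs <;> omega
  by_cases hve : v.1 + 1 = c
  · refine ⟨{z, v}, induce_connected_of_rank (a := z) (by simp) Fin.val ?_,
      fun i => ⟨if i.1 + 3 = r then 1 else if i.1 + 2 = r then c - 2 else
        if i.1 + 1 = r then u.1 else c + i.1, ?_⟩, ?_, ?_⟩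
    · rintro x (rfl | rfl) hx
      · exact absurd rfl hx
      · refine ⟨z, by simp, by omega, ?_⟩
        rw [addEdge_adj hne, pendantCycle_adj]; omega
    · have := i.2
      split_ifs <;> omega
    · intro i j hij
      simp only [Fin.mk.injEq] at hij
      ext
      split_ifs at hij <;> omega
    · intro i
      have := i.2
      simp only [Set.mem_insert_iff, Set.mem_singleton_iff]
      refine ⟨by simp only [Fin.ext_iff]; split_ifs <;> omega, ?_⟩
      by_cases h : i.1 + 2 = r ∨ i.1 + 1 = r
      · refine ⟨v, by simp, ?_⟩
        simp only [Fin.ext_iff, true_and]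
        split_ifs <;> omega
      · refine ⟨z, by simp, ?_⟩
        simp only [Fin.ext_iff]
        split_ifs <;> omega
  · refine ⟨{x | x.1 ≤ u.1}, induce_connected_of_rank (a := z) (show z.1 ≤ u.1 by omega) Fin.val ?_,
      fun i => ⟨if i.1 + 3 = r then u.1 + 1 else if i.1 + 2 = r then v.1 else
        if i.1 + 1 = r then c - 1 else c + i.1, ?_⟩, ?_, ?_⟩
    · intro x hx hxz
      have hx' : x.1 ≤ u.1 := hx
      have : x.1 ≠ 0 := fun h => hxz (Fin.ext (h.trans hz.symm))
      refine ⟨⟨x.1 - 1, by omega⟩, show x.1 - 1 ≤ u.1 by omega,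
        show x.1 - 1 < x.1 by omega, ?_⟩
      rw [addEdge_adj hne, pendantCycle_adj]
      simp only
      omega
    · have := i.2
      split_ifs <;> omega
    · intro i j hij
      simp only [Fin.mk.injEq] at hij
      ext
      split_ifs at hij <;> omega
    · intro i
      have := i.2
      simp only [Set.mem_ofPred_eq]
      refine ⟨by split_ifs <;> omega, ?_⟩
      by_cases h : i.1 + 3 = r ∨ i.1 + 2 = r
      · refine ⟨u, le_rfl, ?_⟩
        simp only [Fin.ext_iff, true_and]
        split_ifs <;> omega
      · refine ⟨z, show z.1 ≤ u.1 by omega, ?_⟩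
        simp only [Fin.ext_iff]
        split_ifs <;> omega

theorem exists_minorSaturated_ge [Finite V] {H : SimpleGraph W} {G : SimpleGraph V}
    (hG : ¬ H.IsMinorOf G) : ∃ G', G ≤ G' ∧ MinorSaturated H G' := by
  obtain ⟨G', hle, hmax⟩ := Set.Finite.exists_le_maximal
    (Set.toFinite {G : SimpleGraph V | ¬ H.IsMinorOf G}) hG
  refine ⟨G', hle, hmax.prop, fun u v huv hadj => ?_⟩
  by_contra h
  exact hadj (hmax.le_of_ge h le_sup_left ((addEdge_adj huv).2 (.inr (.inl ⟨rfl, rfl⟩))))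

theorem edgeSet_ncard_le_of_pendantCycle_le {n c r : ℕ} (hc : 8 ≤ c) (hn : c + r = n + 3) (hr : 3 ≤ r)
    {G : SimpleGraph (Fin n)} (hle : pendantCycle n c ≤ G)
    (hG : ¬ (completeBipartiteGraph (Fin 1) (Fin r)).IsMinorOf G) :
    G.edgeSet.ncard ≤ n + (r + 2) * (r + 2) := by
  classical
  let f : Fin n → Sym2 (Fin n) := fun b =>
    if b.1 = 0 then s(⟨0, by omega⟩, ⟨c - 1, by omega⟩)
    else if b.1 < c then s(⟨b.1 - 1, by omega⟩, b) else s(⟨0, by omega⟩, b)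
  let X : Finset (Fin n) := Finset.univ.filter fun x => x.1 < 3 ∨ c ≤ x.1 + 2
  have hX : X.card ≤ r + 2 := by
    have h := Finset.card_le_card_of_injOn (s := X) (t := Finset.range 3 ∪ Finset.Ico (c - 2) n)
      Fin.val (by intro x; simp [X]) Fin.val_injective.injOn
    have h' := Finset.card_union_le (Finset.range 3) (Finset.Ico (c - 2) n)
    rw [Nat.card_Ico, Finset.card_range] at h'
    omega
  let E : Finset (Sym2 (Fin n)) :=
    Finset.univ.image f ∪ (X ×ˢ X).image fun p => s(p.1, p.2)
  have key (u v : Fin n) (huv : u.1 < v.1) (h : G.Adj u v) : s(u, v) ∈ E := by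
    by_cases hX' : (u.1 < 3 ∨ c ≤ u.1 + 2) ∧ (v.1 < 3 ∨ c ≤ v.1 + 2)
    · refine Finset.mem_union_right _ (Finset.mem_image.2 ⟨(u, v), ?_, rfl⟩)
      simpa [X] using hX'
    refine Finset.mem_union_left _ (Finset.mem_image.2 ?_)
    have hadj : (pendantCycle n c).Adj u v := by
      by_contra hadj
      refine hG ((star_isMinorOf_addEdge_pendantCycle hc hn hr huv hadj hX').mono ?_)
      intro a b hab
      obtain hab | ⟨rfl, rfl⟩ | ⟨rfl, rfl⟩ := (addEdge_adj (Fin.ne_of_lt huv)).1 hab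
      exacts [hle hab, h, h.symm]
    rw [pendantCycle_adj] at hadj
    have hcase : (u.1 + 1 = v.1 ∧ v.1 < c) ∨ (u.1 = 0 ∧ v.1 + 1 = c) ∨
        (u.1 = 0 ∧ c ≤ v.1) := by omega
    obtain ⟨h₁, h₂⟩ | ⟨h₁, h₂⟩ | ⟨h₁, h₂⟩ := hcase
    · refine ⟨v, Finset.mem_univ _, ?_⟩
      simp only [f, if_neg (show v.1 ≠ 0 by omega), if_pos h₂]
      congr 2
      omega
    · refine ⟨u, Finset.mem_univ _, ?_⟩
      simp only [f, if_pos h₁]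
      congr 2 <;> omega
    · refine ⟨v, Finset.mem_univ _, ?_⟩
      simp only [f, if_neg (show v.1 ≠ 0 by omega), if_neg (not_lt.2 h₂)]
      congr 2
      exact h₁.symm
  have hsub : G.edgeSet ⊆ E := by
    intro e
    induction e with
    | _ u v =>
      intro h
      obtain huv | huv := lt_or_gt_of_ne (Fin.val_ne_of_ne (G.ne_of_adj h))
      · exact key u v huv h
      · exact Sym2.eq_swap ▸ key v u huv (G.adj_symm h)
  calc G.edgeSet.ncard ≤ (E : Set (Sym2 (Fin n))).ncard := Set.ncard_le_ncard hsub E.finite_toSet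
    _ = E.card := Set.ncard_coe_finset E
    _ ≤ _ := Finset.card_union_le _ _
    _ ≤ n + X.card * X.card := by
      gcongr
      · exact Finset.card_image_le.trans (Finset.card_fin n).le
      · exact Finset.card_image_le.trans (Finset.card_product X X).le
    _ ≤ _ := by gcongr

end SimpleGraph

/-- `sat(n, M(K_{1,r})) ≤ n + O_r(1)` for all `r ≥ 3`. -/
theorem sat_minor_star_upper_bound (r : ℕ) (hr : 3 ≤ r) :
    ∃ C : ℕ, ∃ N : ℕ, ∀ n ≥ N, ∃ G : SimpleGraph (Fin n),
      MinorSaturated (completeBipartiteGraph (Fin 1) (Fin r)) G ∧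
      G.edgeSet.ncard ≤ n + C := by
  refine ⟨(r + 2) * (r + 2), r + 5, fun n hn => ?_⟩
  have hcn : n + 3 - r + r = n + 3 := by omega
  obtain ⟨G, hle, hG⟩ := SimpleGraph.exists_minorSaturated_ge
    (SimpleGraph.not_star_isMinorOf_pendantCycle hcn hr)
  exact ⟨G, hG, SimpleGraph.edgeSet_ncard_le_of_pendantCycle_le (by omega) hcn hr hle hG.1⟩
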